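/- Let n ≥ 1 and let S = (S_0, S_1, …, S_n) be an S-path of n+1 coordinates with increments m_j = S_j − S_{j−1}. Then the number of partitions p of {1, …, n} that correspond to S equals the product over all j ∈ {1, …, n} with m_j > 0 of the binomial coefficients binom(j − 1 − S_{j−1}, j − S_j). -/

import Mathlib

/-- An S-path of `n+1` coordinates. -/
def IsSPath (n : ℕ) (S : ℕ → ℕ) : Prop :=
  S 0 = 0 ∧ S n = n ∧ (∀ j < n, S j ≤ j) ∧ ∀ j < n, S j ≤ S (j + 1)

/-- A partition `p` of `{1,…,n}` corresponds to the S-path `S`. -/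
def Corresponds (n : ℕ) (p : Finpartition (Finset.Icc 1 n)) (S : ℕ → ℕ) : Prop :=
  ∀ j ∈ Finset.Icc 1 n,
    ((∃ C ∈ p.parts, C.sup id = j) ↔ S (j - 1) < S j) ∧
    ∀ C ∈ p.parts, C.sup id = j → C.card = S j - S (j - 1)

/-- `P` is a family of disjoint cells in `{1,…,k}` whose maxima and sizes are those prescribed by
the first `k` increments of `S`. The cells need not cover `{1,…,k}`. -/
structure IsPartialPartition (S : ℕ → ℕ) (k : ℕ) (P : Finset (Finset ℕ)) : Prop where
  nonempty : ∀ C ∈ P, C.Nonempty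
  subset : ∀ C ∈ P, C ⊆ Finset.Icc 1 k
  disjoint : (P : Set (Finset ℕ)).PairwiseDisjoint id
  corr : ∀ j ∈ Finset.Icc 1 k,
    ((∃ C ∈ P, C.sup id = j) ↔ S (j - 1) < S j) ∧
    ∀ C ∈ P, C.sup id = j → C.card = S j - S (j - 1)

theorem Finset.Nonempty.sup_id_mem {C : Finset ℕ} (hC : C.Nonempty) : C.sup id ∈ C := by
  obtain ⟨x, hx, h⟩ := Finset.exists_mem_eq_sup C hC id
  rw [h]
  exact hx

theorem Finset.sup_id_insert_succ {k : ℕ} {D : Finset ℕ} (hD : D ⊆ Finset.Icc 1 k) :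
    (insert (k + 1) D).sup id = k + 1 := by
  refine le_antisymm (Finset.sup_le fun x hx => ?_)
    (Finset.le_sup (f := id) (Finset.mem_insert_self _ _))
  rcases Finset.mem_insert.1 hx with rfl | hx
  · exact le_rfl
  · have := Finset.mem_Icc.1 (hD hx)
    simp only [id]
    omega

theorem Finset.subset_Icc_of_succ_notMem {k : ℕ} {C : Finset ℕ} (hC : C ⊆ Finset.Icc 1 (k + 1))
    (h : k + 1 ∉ C) : C ⊆ Finset.Icc 1 k := by
  intro x hx
  have h1 := Finset.mem_Icc.1 (hC hx)
  have h2 : x ≠ k + 1 := fun e => h (e ▸ hx)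
  exact Finset.mem_Icc.2 ⟨h1.1, by omega⟩

theorem Finset.sup_id_eq_of_mem_Icc {k : ℕ} {C : Finset ℕ} (hC : C ⊆ Finset.Icc 1 k)
    (h : k ∈ C) : C.sup id = k :=
  le_antisymm (Finset.sup_le fun _ hx => (Finset.mem_Icc.1 (hC hx)).2) (Finset.le_sup (f := id) h)

namespace IsPartialPartition

variable {S : ℕ → ℕ} {k : ℕ} {P : Finset (Finset ℕ)}

theorem sup_id_le (hP : IsPartialPartition S k P) {C : Finset ℕ} (hC : C ∈ P) : C.sup id ≤ k :=
  (Finset.mem_Icc.1 (hP.subset C hC (hP.nonempty C hC).sup_id_mem)).2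

theorem zero_iff : IsPartialPartition S 0 P ↔ P = ∅ := by
  constructor
  · intro h
    refine Finset.eq_empty_of_forall_notMem fun C hC => ?_
    obtain ⟨x, hx⟩ := h.nonempty C hC
    simpa using h.subset C hC hx
  · rintro rfl
    exact ⟨by simp, by simp, by simp, by simp⟩

theorem succ_iff_of_not_lt (h : ¬ S k < S (k + 1)) :
    IsPartialPartition S (k + 1) P ↔ IsPartialPartition S k P := by
  constructor
  · intro hP
    refine ⟨hP.nonempty, fun C hC => ?_, hP.disjoint, fun j hj =>
      hP.corr j (Finset.Icc_subset_Icc_right k.le_succ hj)⟩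
    refine Finset.subset_Icc_of_succ_notMem (hP.subset C hC) fun hk => h ?_
    exact (hP.corr (k + 1) (by simp)).1.1
      ⟨C, hC, Finset.sup_id_eq_of_mem_Icc (hP.subset C hC) hk⟩
  · intro hP
    refine ⟨hP.nonempty, fun C hC => (hP.subset C hC).trans
      (Finset.Icc_subset_Icc_right k.le_succ), hP.disjoint, fun j hj => ?_⟩
    have hj' := Finset.mem_Icc.1 hj
    rcases Nat.lt_or_ge k j with hkj | hkj
    · obtain rfl : j = k + 1 := by omega
      have key : ∀ C ∈ P, C.sup id ≠ k + 1 := fun C hC => by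
        have := hP.sup_id_le hC
        omega
      exact ⟨⟨fun ⟨C, hC, e⟩ => (key C hC e).elim, fun h' => (h h').elim⟩,
        fun C hC e => (key C hC e).elim⟩
    · exact hP.corr j (Finset.mem_Icc.2 ⟨hj'.1, hkj⟩)

theorem notMem_of_subset_sdiff {Q : Finset (Finset ℕ)} {D C : Finset ℕ}
    (hD : D ⊆ Finset.Icc 1 k \ Q.sup id) (hC : C ∈ Q) {x : ℕ} (hx : x ∈ C) : x ∉ D := fun hxD =>
  (Finset.mem_sdiff.1 (hD hxD)).2 (Finset.le_sup (f := id) hC hx)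

theorem succ_notMem (hP : IsPartialPartition S k P) {C : Finset ℕ} (hC : C ∈ P) : k + 1 ∉ C :=
  fun h => by simpa using hP.subset C hC h

theorem insert_insert {Q : Finset (Finset ℕ)} {D : Finset ℕ} (h : S k < S (k + 1))
    (hQ : IsPartialPartition S k Q) (hD : D ⊆ Finset.Icc 1 k \ Q.sup id)
    (hcard : D.card = S (k + 1) - S k - 1) :
    IsPartialPartition S (k + 1) (insert (insert (k + 1) D) Q) := by
  have hD' : D ⊆ Finset.Icc 1 k := hD.trans Finset.sdiff_subset
  have hsup := Finset.sup_id_insert_succ hD'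
  have hk : k + 1 ∉ D := fun h => by simpa using hD' h
  refine ⟨?_, ?_, ?_, ?_⟩
  · intro C hC
    rcases Finset.mem_insert.1 hC with rfl | hC
    · exact Finset.insert_nonempty _ _
    · exact hQ.nonempty C hC
  · intro C hC
    rcases Finset.mem_insert.1 hC with rfl | hC
    · exact Finset.insert_subset (by simp) (hD'.trans (Finset.Icc_subset_Icc_right k.le_succ))
    · exact (hQ.subset C hC).trans (Finset.Icc_subset_Icc_right k.le_succ)
  · rw [Finset.coe_insert]
    refine hQ.disjoint.insert fun C hC _ => ?_
    refine Finset.disjoint_right.2 fun x hx hx' => ?_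
    rcases Finset.mem_insert.1 hx' with rfl | hx'
    · exact hQ.succ_notMem hC hx
    · exact notMem_of_subset_sdiff hD hC hx hx'
  · intro j hj
    have hj' := Finset.mem_Icc.1 hj
    rcases Nat.lt_or_ge k j with hkj | hkj
    · obtain rfl : j = k + 1 := by omega
      refine ⟨⟨fun _ => h, fun _ => ⟨_, Finset.mem_insert_self _ _, hsup⟩⟩, fun C hC e => ?_⟩
      rcases Finset.mem_insert.1 hC with rfl | hC
      · rw [Finset.card_insert_of_notMem hk, hcard, Nat.add_sub_cancel]
        omega
      · have := hQ.sup_id_le hC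
        omega
    · have hne : (insert (k + 1) D).sup id ≠ j := by omega
      have hc := hQ.corr j (Finset.mem_Icc.2 ⟨hj'.1, hkj⟩)
      refine ⟨?_, fun C hC e => ?_⟩
      · rw [← hc.1, Finset.exists_mem_insert]
        exact or_iff_right hne
      · rcases Finset.mem_insert.1 hC with rfl | hC
        · exact (hne e).elim
        · exact hc.2 C hC e

theorem exists_eq_insert_insert (h : S k < S (k + 1)) (hP : IsPartialPartition S (k + 1) P) :
    ∃ Q D, IsPartialPartition S k Q ∧ D ⊆ Finset.Icc 1 k \ Q.sup id ∧
      D.card = S (k + 1) - S k - 1 ∧ insert (insert (k + 1) D) Q = P := by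
  have hc := hP.corr (k + 1) (by simp)
  obtain ⟨C, hC, hCsup⟩ := hc.1.2 h
  have hkC : k + 1 ∈ C := hCsup ▸ (hP.nonempty C hC).sup_id_mem
  have hdisj : ∀ E ∈ P.erase C, Disjoint E C := fun E hE =>
    hP.disjoint (Finset.mem_of_mem_erase hE) hC (Finset.ne_of_mem_erase hE)
  refine ⟨P.erase C, C.erase (k + 1), ⟨?_, ?_, ?_, ?_⟩, ?_, ?_, ?_⟩
  · exact fun E hE => hP.nonempty E (Finset.mem_of_mem_erase hE)
  · exact fun E hE => Finset.subset_Icc_of_succ_notMem (hP.subset E (Finset.mem_of_mem_erase hE))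
      (Finset.disjoint_right.1 (hdisj E hE) hkC)
  · exact hP.disjoint.subset (Finset.coe_subset.2 (Finset.erase_subset _ _))
  · intro j hj
    have hj' := Finset.mem_Icc.1 hj
    have hcj := hP.corr j (Finset.Icc_subset_Icc_right k.le_succ hj)
    refine ⟨⟨fun ⟨E, hE, e⟩ => hcj.1.1 ⟨E, Finset.mem_of_mem_erase hE, e⟩, fun hlt => ?_⟩,
      fun E hE e => hcj.2 E (Finset.mem_of_mem_erase hE) e⟩
    obtain ⟨E, hE, e⟩ := hcj.1.2 hlt
    refine ⟨E, Finset.mem_erase.2 ⟨?_, hE⟩, e⟩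
    rintro rfl
    omega
  · intro x hx
    have hxC := Finset.mem_of_mem_erase hx
    refine Finset.mem_sdiff.2 ⟨Finset.subset_Icc_of_succ_notMem
      ((Finset.erase_subset _ _).trans (hP.subset C hC)) (Finset.notMem_erase _ _) hx, fun hs => ?_⟩
    obtain ⟨E, hE, hxE⟩ := Finset.mem_sup.1 hs
    exact Finset.disjoint_left.1 (hdisj E hE) hxE hxC
  · rw [Finset.card_erase_of_mem hkC, hc.2 C hC hCsup, Nat.add_sub_cancel]
  · rw [Finset.insert_erase hkC, Finset.insert_erase hC]

theorem insert_insert_inj {Q Q' : Finset (Finset ℕ)} {D D' : Finset ℕ}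
    (hQ : IsPartialPartition S k Q) (hQ' : IsPartialPartition S k Q')
    (hD : k + 1 ∉ D) (hD' : k + 1 ∉ D')
    (h : insert (insert (k + 1) D) Q = insert (insert (k + 1) D') Q') : Q = Q' ∧ D = D' := by
  have hmem : insert (k + 1) D ∈ insert (insert (k + 1) D') Q' := h ▸ Finset.mem_insert_self _ _
  have hins : insert (k + 1) D = insert (k + 1) D' :=
    (Finset.mem_insert.1 hmem).resolve_right fun hm =>
      hQ'.succ_notMem hm (Finset.mem_insert_self _ _)
  constructor
  · rw [← hins] at h
    have h1 : insert (k + 1) D ∉ Q := fun hm => hQ.succ_notMem hm (Finset.mem_insert_self _ _)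
    have h2 : insert (k + 1) D ∉ Q' := fun hm => hQ'.succ_notMem hm (Finset.mem_insert_self _ _)
    rw [← Finset.erase_insert h1, h, Finset.erase_insert h2]
  · rw [← Finset.erase_insert hD, hins, Finset.erase_insert hD']

theorem sup_subset (hP : IsPartialPartition S k P) : P.sup id ⊆ Finset.Icc 1 k :=
  Finset.sup_le hP.subset

theorem card_sup {n : ℕ} (hS : S 0 = 0) (hmono : ∀ j < n, S j ≤ S (j + 1)) (hk : k ≤ n)
    (hP : IsPartialPartition S k P) : (P.sup id).card = S k := by
  induction k generalizing P with
  | zero =>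
    rw [zero_iff.1 hP, hS]
    rfl
  | succ k ih =>
    by_cases h : S k < S (k + 1)
    · obtain ⟨Q, D, hQ, hD, hcard, rfl⟩ := hP.exists_eq_insert_insert h
      have hk1 : k + 1 ∉ D := fun h => by simpa using (hD.trans Finset.sdiff_subset) h
      have hdisj : Disjoint (insert (k + 1) D) (Q.sup id) := by
        refine Finset.disjoint_insert_left.2 ⟨fun hm => by simpa using hQ.sup_subset hm, ?_⟩
        exact Finset.sdiff_disjoint.mono_left hD
      rw [Finset.sup_insert, id, Finset.sup_eq_union, Finset.card_union_of_disjoint hdisj,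
        Finset.card_insert_of_notMem hk1, hcard, ih (by omega) hQ]
      omega
    · rw [ih (by omega) ((succ_iff_of_not_lt h).1 hP)]
      exact le_antisymm (hmono k hk) (not_lt.1 h)

theorem exists_finset {n : ℕ} (hS : IsSPath n S) (hk : k ≤ n) :
    ∃ A : Finset (Finset (Finset ℕ)), (∀ P, P ∈ A ↔ IsPartialPartition S k P) ∧
      A.card = ∏ j ∈ (Finset.Icc 1 k).filter (fun j => S (j - 1) < S j),
        Nat.choose (j - 1 - S (j - 1)) (j - S j) := by
  obtain ⟨h0, hn, hle, hmono⟩ := hS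
  induction k with
  | zero => exact ⟨{∅}, fun P => by rw [zero_iff, Finset.mem_singleton], by simp⟩
  | succ k ih =>
    obtain ⟨A, hA, hcard⟩ := ih (by omega)
    rw [← Finset.insert_Icc_right_eq_Icc_add_one (by omega), Finset.filter_insert,
      Nat.add_sub_cancel]
    by_cases h : S k < S (k + 1)
    · have hle' : S (k + 1) ≤ k + 1 := by
        rcases Nat.lt_or_ge (k + 1) n with hlt | hge
        · exact hle _ hlt
        · obtain rfl : k + 1 = n := by omega
          exact hn.le
      rw [if_pos h, Finset.prod_insert (by simp), ← hcard, Nat.add_sub_cancel]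
      refine ⟨(A.sigma fun Q => (Finset.Icc 1 k \ Q.sup id).powersetCard
        (S (k + 1) - S k - 1)).image fun x => insert (insert (k + 1) x.2) x.1, fun P => ?_, ?_⟩
      · simp only [Finset.mem_image, Finset.mem_sigma, Finset.mem_powersetCard, hA]
        constructor
        · rintro ⟨⟨Q, D⟩, ⟨hQ, hD, hc⟩, rfl⟩
          exact hQ.insert_insert h hD hc
        · intro hP
          obtain ⟨Q, D, hQ, hD, hc, e⟩ := hP.exists_eq_insert_insert h
          exact ⟨⟨Q, D⟩, ⟨hQ, hD, hc⟩, e⟩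
      · rw [Finset.card_image_of_injOn, Finset.card_sigma, Finset.sum_const_nat, mul_comm]
        · intro Q hQ
          have hQ := (hA Q).1 hQ
          rw [Finset.card_powersetCard, Finset.card_sdiff_of_subset hQ.sup_subset,
            hQ.card_sup h0 hmono (by omega), Nat.card_Icc, Nat.add_sub_cancel]
          exact Nat.choose_symm_of_eq_add (by omega)
        · rintro ⟨Q, D⟩ hx ⟨Q', D'⟩ hx' e
          simp only [Finset.coe_sigma, Set.mem_sigma_iff, Finset.mem_coe, hA,
            Finset.mem_powersetCard] at hx hx'
          have hk1 : ∀ {R : Finset (Finset ℕ)} {E : Finset ℕ},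
              E ⊆ Finset.Icc 1 k \ R.sup id → k + 1 ∉ E := fun hE hm => by
            simpa using (hE.trans Finset.sdiff_subset) hm
          obtain ⟨rfl, rfl⟩ := insert_insert_inj hx.1 hx'.1 (hk1 hx.2.1) (hk1 hx'.2.1) e
          rfl
    · rw [if_neg h]
      exact ⟨A, fun P => by rw [hA, succ_iff_of_not_lt h], hcard⟩

end IsPartialPartition

theorem Corresponds.isPartialPartition {n : ℕ} {S : ℕ → ℕ} {p : Finpartition (Finset.Icc 1 n)}
    (hp : Corresponds n p S) : IsPartialPartition S n p.parts :=
  ⟨fun _ hC => p.nonempty_of_mem_parts hC, fun _ hC => p.le hC, p.disjoint, hp⟩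

/-- A partial partition all of whose cells together cover `{1,…,n}`, as a partition. -/
def IsPartialPartition.toFinpartition {n : ℕ} {S : ℕ → ℕ} {P : Finset (Finset ℕ)}
    (hP : IsPartialPartition S n P) (hsup : P.sup id = Finset.Icc 1 n) :
    Finpartition (Finset.Icc 1 n) where
  parts := P
  supIndep := Finset.supIndep_iff_pairwiseDisjoint.2 hP.disjoint
  sup_parts := hsup
  bot_notMem h := Finset.not_nonempty_empty (hP.nonempty _ h)

/-- The number of partitions of `{1,…,n}` corresponding to a given S-path `S` equals
`∏_{j : m_j > 0} binom(j - 1 - S_{j-1}, j - S_j)`. -/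
theorem card_partitions_corresponding (n : ℕ) (hn : 1 ≤ n) (S : ℕ → ℕ)
    (hS : IsSPath n S) :
    Nat.card {p : Finpartition (Finset.Icc 1 n) // Corresponds n p S} =
      ∏ j ∈ (Finset.Icc 1 n).filter (fun j => S (j - 1) < S j),
        Nat.choose (j - 1 - S (j - 1)) (j - S j) := by
  obtain ⟨A, hA, hcard⟩ := IsPartialPartition.exists_finset hS le_rfl
  have hsup : ∀ P ∈ A, P.sup id = Finset.Icc 1 n := fun P hP => by
    have hP := (hA P).1 hP
    refine Finset.eq_of_subset_of_card_le hP.sup_subset ?_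
    rw [hP.card_sup hS.1 hS.2.2.2 le_rfl, hS.2.1, Nat.card_Icc, Nat.add_sub_cancel]
  rw [← hcard, ← Nat.card_eq_finsetCard]
  exact Nat.card_congr
    { toFun := fun p => ⟨p.1.parts, (hA _).2 p.2.isPartialPartition⟩
      invFun := fun P => ⟨((hA _).1 P.2).toFinpartition (hsup _ P.2), ((hA _).1 P.2).corr⟩
      left_inv := fun _ => rfl
      right_inv := fun _ => rfl }
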